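/- arXiv:2205.01521 — 2 statements merged into one kernel-verified Lean document; each statement's English description precedes it below -/
import Mathlib

section
/- For every real number k, the integral over the real line ∫_{-∞}^{∞} cos(kx)/cosh(x) dx equals π / cosh(πk/2). -/
open Real MeasureTheory

theorem Real.sigmoid_two_mul (x : ℝ) : sigmoid (2 * x) = exp x / (2 * cosh x) := by
  rw [sigmoid_def, cosh_eq, show -(2 * x) = -x + -x by ring, exp_add, exp_neg]
  have := exp_pos x
  field_simp

theorem Real.hasDerivAt_sigmoid_two_mul (x : ℝ) :
    HasDerivAt (fun y => sigmoid (2 * y)) (1 / (2 * cosh x ^ 2)) x := by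
  have h := (hasDerivAt_sigmoid (2 * x)).comp x ((hasDerivAt_id x).const_mul 2)
  refine h.congr_deriv ?_
  have hc := cosh_pos x
  rw [← sigmoid_neg, show -(2 * x) = 2 * -x by ring, sigmoid_two_mul, sigmoid_two_mul, cosh_neg,
    exp_neg]
  have := exp_pos x
  field_simp

theorem Real.injective_sigmoid_two_mul : Function.Injective fun x : ℝ => sigmoid (2 * x) :=
  fun x y h => by simpa using sigmoid_injective h

theorem Real.range_sigmoid_two_mul :
    Set.range (fun x : ℝ => sigmoid (2 * x)) = Set.Ioo 0 1 := by
  rw [← range_sigmoid]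
  exact (mul_left_surjective₀ (two_ne_zero' ℝ)).range_comp sigmoid

/-- The integrand of `B(1/2 + ik/2, 1/2 - ik/2)` after the substitution `t = sigmoid (2 * x)`. -/
theorem Complex.betaIntegrand_sigmoid_two_mul (k x : ℝ) :
    |1 / (2 * Real.cosh x ^ 2)| •
      (((sigmoid (2 * x) : ℝ) : ℂ) ^ ((1 / 2 + k / 2 * I : ℂ) - 1) *
        (1 - ((sigmoid (2 * x) : ℝ) : ℂ)) ^ ((1 / 2 - k / 2 * I : ℂ) - 1)) =
      exp ((k * x : ℝ) * I) / (Real.cosh x : ℂ) := by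
  have hc := Real.cosh_pos x
  have hlog (y : ℝ) : Complex.log ((sigmoid (2 * y) : ℝ) : ℂ) =
      ((y - Real.log (2 * Real.cosh y) : ℝ) : ℂ) := by
    rw [← ofReal_log (sigmoid_nonneg _), sigmoid_two_mul,
      Real.log_div (Real.exp_pos y).ne' (by have := Real.cosh_pos y; positivity), Real.log_exp]
  have hne (y : ℝ) : ((sigmoid (2 * y) : ℝ) : ℂ) ≠ 0 := ofReal_ne_zero.2 (sigmoid_pos _).ne'
  have hsub : 1 - ((sigmoid (2 * x) : ℝ) : ℂ) = ((sigmoid (2 * -x) : ℝ) : ℂ) := by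
    rw [mul_neg, sigmoid_neg]
    push_cast
    rfl
  have hexp : exp ((Real.log (2 * Real.cosh x) : ℝ) : ℂ) = ((2 * Real.cosh x : ℝ) : ℂ) := by
    rw [← ofReal_exp, Real.exp_log (by positivity)]
  rw [hsub, cpow_def_of_ne_zero (hne _), cpow_def_of_ne_zero (hne _), hlog, hlog, Real.cosh_neg,
    ← exp_add, abs_of_pos (by positivity), real_smul]
  have harg : ((x - Real.log (2 * Real.cosh x) : ℝ) : ℂ) * ((1 / 2 + k / 2 * I : ℂ) - 1) +
      ((-x - Real.log (2 * Real.cosh x) : ℝ) : ℂ) * ((1 / 2 - k / 2 * I : ℂ) - 1) =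
      (k * x : ℝ) * I + (Real.log (2 * Real.cosh x) : ℝ) := by
    push_cast
    ring
  rw [harg, exp_add, hexp]
  have hc' : (Real.cosh x : ℂ) ≠ 0 := ofReal_ne_zero.2 hc.ne'
  rw [ofReal_div, ofReal_mul, ofReal_mul, ofReal_pow]
  push_cast at hc' ⊢
  field_simp

theorem Complex.betaIntegral_half_add_half_sub (k : ℝ) :
    betaIntegral (1 / 2 + k / 2 * I) (1 / 2 - k / 2 * I) =
      ((π / Real.cosh (π * k / 2) : ℝ) : ℂ) := by
  have h := Gamma_mul_Gamma_eq_betaIntegral (s := 1 / 2 + k / 2 * I) (t := 1 / 2 - k / 2 * I)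
    (by simp) (by simp)
  have hsum : (1 / 2 + k / 2 * I : ℂ) + (1 / 2 - k / 2 * I) = 1 := by ring
  rw [hsum, Gamma_one, one_mul,
    show (1 / 2 - k / 2 * I : ℂ) = 1 - (1 / 2 + k / 2 * I) by ring, Gamma_mul_Gamma_one_sub] at h
  rw [show (1 / 2 - k / 2 * I : ℂ) = 1 - (1 / 2 + k / 2 * I) by ring, ← h,
    show (π : ℂ) * (1 / 2 + k / 2 * I) = (π * k / 2) * I + π / 2 by ring, sin_add_pi_div_two,
    cos_mul_I]
  push_cast
  rfl

theorem integrable_exp_mul_I_div_cosh (k : ℝ) :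
    Integrable fun x : ℝ => Complex.exp ((k * x : ℝ) * Complex.I) / (Real.cosh x : ℂ) := by
  have h := Complex.betaIntegral_convergent (u := 1 / 2 + k / 2 * Complex.I)
    (v := 1 / 2 - k / 2 * Complex.I) (by simp) (by simp)
  rw [intervalIntegrable_iff_integrableOn_Ioo_of_le zero_le_one, ← range_sigmoid_two_mul,
    ← Set.image_univ, integrableOn_image_iff_integrableOn_abs_deriv_smul MeasurableSet.univ
      (fun x _ => (hasDerivAt_sigmoid_two_mul x).hasDerivWithinAt)
      injective_sigmoid_two_mul.injOn, integrableOn_univ] at h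
  simpa only [Complex.betaIntegrand_sigmoid_two_mul] using h

theorem integral_exp_mul_I_div_cosh (k : ℝ) :
    ∫ x : ℝ, Complex.exp ((k * x : ℝ) * Complex.I) / (Real.cosh x : ℂ) =
      ((π / Real.cosh (π * k / 2) : ℝ) : ℂ) := by
  rw [← Complex.betaIntegral_half_add_half_sub, Complex.betaIntegral,
    intervalIntegral.integral_of_le zero_le_one, integral_Ioc_eq_integral_Ioo,
    ← range_sigmoid_two_mul, ← Set.image_univ,
    integral_image_eq_integral_abs_deriv_smul MeasurableSet.univ
      (fun x _ => (hasDerivAt_sigmoid_two_mul x).hasDerivWithinAt)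
      injective_sigmoid_two_mul.injOn, setIntegral_univ]
  simp only [Complex.betaIntegrand_sigmoid_two_mul]

theorem cos_div_cosh_integral (k : ℝ) :
    ∫ x : ℝ, Real.cos (k * x) / Real.cosh x = π / Real.cosh (π * k / 2) := by
  have h := integral_re (integrable_exp_mul_I_div_cosh k)
  rw [integral_exp_mul_I_div_cosh] at h
  simpa only [RCLike.re_to_complex, Complex.div_ofReal_re, Complex.exp_ofReal_mul_I_re,
    Complex.ofReal_re] using h
end

section
/- For every real number k, π sech(πk/2) = 4 ∑_{n=0}^{∞} (-1)^n (2n+1)/(k² + (2n+1)²), where the series on the right converges. -/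
open Real Filter Topology

lemma Complex.re_cot_pi_div_four_add_mul_I (y : ℝ) :
    (Complex.cot (π / 4 + y / 2 * Complex.I)).re = 1 / Real.cosh y := by
  set a : ℂ := π / 4 + y / 2 * Complex.I with ha
  have h2a : 2 * a = y * Complex.I + π / 2 := by rw [ha]; ring
  have hsin : 2 * Complex.sin a * Complex.cos a = Real.cosh y := by
    rw [← Complex.sin_two_mul, h2a, Complex.sin_add_pi_div_two, Complex.cos_mul_I,
      Complex.ofReal_cosh]
  have hcos : 2 * Complex.cos a ^ 2 = 1 - Real.sinh y * Complex.I := by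
    have := Complex.cos_two_mul a
    rw [h2a, Complex.cos_add_pi_div_two, Complex.sin_mul_I, ← Complex.ofReal_sinh] at this
    linear_combination -this
  have hcosh : (Real.cosh y : ℂ) ≠ 0 := by exact_mod_cast (Real.cosh_pos y).ne'
  have hcot : Complex.cot a = (1 - Real.sinh y * Complex.I) / Real.cosh y := by
    rw [← hsin] at hcosh ⊢
    rw [← hcos, Complex.cot_eq_cos_div_sin]
    have h1 : Complex.sin a ≠ 0 := fun h => hcosh (by simp [h])
    have h2 : Complex.cos a ≠ 0 := fun h => hcosh (by simp [h])
    field_simp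
  rw [hcot, Complex.div_ofReal_re]
  simp

lemma Filter.Tendsto.sum_range_of_odd {f : ℕ → ℝ} {l : ℝ} (hf : Tendsto f atTop (𝓝 0))
    (h : Tendsto (fun N => ∑ n ∈ Finset.range (2 * N + 1), f n) atTop (𝓝 l)) :
    Tendsto (fun N => ∑ n ∈ Finset.range N, f n) atTop (𝓝 l) := by
  have hdiv : Tendsto (fun N : ℕ => N / 2) atTop atTop :=
    Nat.tendsto_div_const_atTop two_ne_zero
  have hcorr : Tendsto (fun N : ℕ => if Even N then f N else 0) atTop (𝓝 0) := by
    refine squeeze_zero_norm (fun N => ?_) (by simpa using hf.norm)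
    split_ifs <;> simp
  have key := (h.comp hdiv).sub hcorr
  rw [sub_zero] at key
  refine key.congr fun N => ?_
  rcases Nat.even_or_odd' N with ⟨m, rfl | rfl⟩
  · simp [Finset.sum_range_succ]
  · have : (2 * m + 1) / 2 = m := by omega
    simp [this]

lemma tendsto_alternating_odd_div_sq_add_sq_zero (k : ℝ) :
    Tendsto (fun n : ℕ => (-1 : ℝ) ^ n * (2 * n + 1) / (k ^ 2 + (2 * n + 1) ^ 2))
      atTop (𝓝 0) := by
  refine squeeze_zero_norm (fun n => ?_) tendsto_one_div_add_atTop_nhds_zero_nat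
  have hn : (0 : ℝ) ≤ n := n.cast_nonneg
  rw [norm_div, norm_mul, norm_pow, norm_neg, norm_one, one_pow, one_mul,
    Real.norm_of_nonneg (by positivity), Real.norm_of_nonneg (by positivity),
    div_le_div_iff₀ (by positivity) (by positivity)]
  nlinarith [sq_nonneg k]

lemma re_inv_add_sum_cotTerm (k : ℝ) (N : ℕ) :
    (1 / ((1 + k * Complex.I) / 4) +
      ∑ j ∈ Finset.range N, cotTerm ((1 + k * Complex.I) / 4) j).re =
    4 * ∑ n ∈ Finset.range (2 * N + 1),
      (-1 : ℝ) ^ n * (2 * n + 1) / (k ^ 2 + (2 * n + 1) ^ 2) := by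
  have hre (m : ℝ) : (1 / ((m + k * Complex.I) / 4)).re = 4 * (m / (k ^ 2 + m ^ 2)) := by
    rw [one_div_div, Complex.div_re]
    simp [Complex.normSq_apply]
    ring
  induction N with
  | zero => simpa using hre 1
  | succ N ih =>
    have hsub : (1 + k * Complex.I) / 4 - ((N : ℂ) + 1)
        = ((-(4 * N + 3) : ℝ) + k * Complex.I) / 4 := by push_cast; ring
    have hadd : (1 + k * Complex.I) / 4 + ((N : ℂ) + 1)
        = ((4 * N + 5 : ℝ) + k * Complex.I) / 4 := by push_cast; ring
    rw [Finset.sum_range_succ, ← add_assoc, Complex.add_re, ih, cotTerm, hsub, hadd,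
      Complex.add_re, hre, hre, show 2 * (N + 1) + 1 = 2 * N + 1 + 1 + 1 by ring,
      Finset.sum_range_succ _ (2 * N + 1 + 1), Finset.sum_range_succ _ (2 * N + 1),
      mul_add 4, mul_add 4, add_assoc (4 * _ : ℝ)]
    congr 1
    have hpow : (-1 : ℝ) ^ (2 * N) = 1 := by simp [pow_mul]
    rw [pow_succ _ (2 * N + 1), pow_succ _ (2 * N), hpow]
    push_cast
    ring

theorem sech_spectrum_alternating_series (k : ℝ) :
    Tendsto (fun N : ℕ => 4 * ∑ n ∈ Finset.range N,
        (-1 : ℝ) ^ n * (2 * n + 1) / (k ^ 2 + (2 * n + 1) ^ 2))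
      atTop (𝓝 (π * (1 / Real.cosh (π * k / 2)))) := by
  set x : ℂ := (1 + k * Complex.I) / 4 with hx
  have hxmem : x ∈ Complex.integerComplement := by
    rw [Complex.mem_integerComplement_iff]
    rintro ⟨m, hm⟩
    have hre := congrArg Complex.re hm
    have h4 : (4 * m : ℝ) = 1 := by
      simp [hx] at hre
      linarith
    have : 4 * m = 1 := by exact_mod_cast h4
    omega
  have hcot := (tendsto_logDeriv_euler_cot_sub hxmem).const_add (1 / x)
  rw [add_sub_cancel] at hcot
  have hlim := (Complex.continuous_re.tendsto _).comp hcot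
  have hval : (π * Complex.cot (π * x)).re = π * (1 / Real.cosh (π * k / 2)) := by
    rw [Complex.re_ofReal_mul, ← Complex.re_cot_pi_div_four_add_mul_I, hx]
    congr 3
    push_cast
    ring
  rw [hval] at hlim
  simp_rw [Finset.mul_sum]
  refine Tendsto.sum_range_of_odd ?_ ?_
  · simpa using (tendsto_alternating_odd_div_sq_add_sq_zero k).const_mul 4
  · refine hlim.congr fun N => ?_
    rw [← Finset.mul_sum]
    exact re_inv_add_sum_cotTerm k N
end
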